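/- Let R be a Lie conformal algebra. On Lie₋R = R[[t]]/(∂+∂_t)R[[t]], the bracket [a_m, b_n] = Σ_{j≥0} C(m,j) (a_{(j)} b)_{m+n−j} is well defined and satisfies skewsymmetry and the Jacobi identity, making Lie₋R a Lie algebra; moreover (∂a)_n = −n a_{n−1} holds in Lie₋R. -/

import Mathlib

noncomputable section

open Finset Polynomial

section BinomialSums

variable {F M : Type*} [Field F] [AddCommGroup M] [Module F M]

/-- The linear functional on polynomials sending `X ^ k` to `f k`. -/
def polyEval (F : Type*) {M : Type*} [Field F] [AddCommGroup M] [Module F M] (f : ℕ → M) :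
    F[X] →ₗ[F] M :=
  (Polynomial.basisMonomials F).constr F f

lemma polyEval_X_pow (f : ℕ → M) (k : ℕ) : polyEval F f (X ^ k) = f k := by
  have h := (Polynomial.basisMonomials F).constr_basis F f k
  simpa [polyEval, Polynomial.X_pow_eq_monomial] using h

lemma sum_choose_X_pow {n K : ℕ} (hK : n < K) :
    ∑ j ∈ range K, (n.choose j : F) • (X ^ j : F[X]) = (X + 1) ^ n := by
  have hsub : range (n + 1) ⊆ range K := range_subset_range.2 hK
  rw [← sum_subset hsub]
  · rw [add_pow]
    refine sum_congr rfl fun j _ => ?_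
    rw [one_pow, mul_one, Polynomial.smul_eq_C_mul, mul_comm, map_natCast]
  · intro j _ hj
    rw [Nat.choose_eq_zero_of_lt (by simpa using hj)]
    simp

/-- Vandermonde's identity in weighted form. -/
lemma sum_choose_mul_choose_smul (f : ℕ → M) (m n : ℕ) :
    ∑ i ∈ range (n + 1), ∑ j ∈ range (m + 1),
        ((n.choose i : F) * (m.choose j : F)) • f (i + j)
      = ∑ q ∈ range (m + n + 1), ((m + n).choose q : F) • f q := by
  have h : ∑ i ∈ range (n + 1), ∑ j ∈ range (m + 1),
      ((n.choose i : F) * (m.choose j : F)) • (X ^ (i + j) : F[X])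
      = ∑ q ∈ range (m + n + 1), ((m + n).choose q : F) • X ^ q := by
    rw [sum_choose_X_pow (Nat.lt_succ_self _), pow_add, mul_comm,
      ← sum_choose_X_pow (Nat.lt_succ_self n), ← sum_choose_X_pow (Nat.lt_succ_self m),
      sum_mul_sum]
    refine sum_congr rfl fun i _ => sum_congr rfl fun j _ => ?_
    rw [smul_mul_smul_comm, pow_add]
  simpa only [map_sum, map_smul, polyEval_X_pow] using congrArg (polyEval F f) h

lemma sum_neg_one_pow_choose_mul_choose_smul (f : ℕ → M) {m n N : ℕ} (hN : m + n < N) :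
    ∑ j ∈ range (m + 1), ∑ t ∈ range N,
        ((-1) ^ j * (m.choose j : F) * ((m + n - j).choose t : F)) • f (j + t)
      = ∑ q ∈ range (n + 1), (n.choose q : F) • f q := by
  have h : ∑ j ∈ range (m + 1), ∑ t ∈ range N,
      ((-1) ^ j * (m.choose j : F) * ((m + n - j).choose t : F)) • (X ^ (j + t) : F[X])
      = ∑ q ∈ range (n + 1), (n.choose q : F) • X ^ q := by
    rw [sum_choose_X_pow (Nat.lt_succ_self _)]
    have hone : ((X + 1) ^ n : F[X]) = (-X + (X + 1)) ^ m * (X + 1) ^ n := by simp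
    rw [hone, add_pow, sum_mul]
    refine sum_congr rfl fun j hj => ?_
    have hj' : j ≤ m := Nat.lt_succ_iff.1 (mem_range.1 hj)
    have hin : ((X + 1) ^ (m - j) * (X + 1) ^ n : F[X])
        = ∑ t ∈ range N, ((m + n - j).choose t : F) • X ^ t := by
      rw [sum_choose_X_pow (by omega), ← pow_add]
      congr 1
      omega
    calc _ = ((-1) ^ j * (m.choose j : F)) • (X ^ j *
          ∑ t ∈ range N, ((m + n - j).choose t : F) • (X ^ t : F[X])) := by
          rw [mul_sum, smul_sum]
          refine sum_congr rfl fun t _ => ?_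
          rw [mul_smul_comm, smul_smul, pow_add]
      _ = _ := by
          rw [← hin, Polynomial.smul_eq_C_mul, neg_pow]
          simp only [map_mul, map_pow, map_neg, map_one, map_natCast]
          ring
  simpa only [map_sum, map_smul, polyEval_X_pow] using congrArg (polyEval F f) h

end BinomialSums

section ModeBracket

variable {F R M : Type*} [Field F] [AddCommGroup R] [Module F R] [AddCommGroup M] [Module F M]
  {D : Module.End F R} {prod : ℕ → R →ₗ[F] R →ₗ[F] R} {p : ℕ → R →ₗ[F] M}

/-- The bracket `[a_m, b_n] = ∑ j, C(m, j) (a_(j) b)_(m + n - j)`, with modes `a_n = p n a`. -/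
def modeBracket (prod : ℕ → R →ₗ[F] R →ₗ[F] R) (p : ℕ → R →ₗ[F] M) (m n : ℕ) :
    R →ₗ[F] R →ₗ[F] M :=
  ∑ j ∈ range (m + 1), (m.choose j : F) • (prod j).compr₂ (p (m + n - j))

lemma modeBracket_apply (m n : ℕ) (a b : R) :
    modeBracket prod p m n a b
      = ∑ j ∈ range (m + 1), (m.choose j : F) • p (m + n - j) (prod j a b) := by
  simp [modeBracket, LinearMap.sum_apply]

lemma modeBracket_deriv_left
    (hsesq1 : ∀ (a b : R) (j : ℕ), prod j (D a) b = -((j : F) • prod (j - 1) a b))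
    (m n : ℕ) (a b : R) :
    modeBracket prod p m n (D a) b + (m : F) • modeBracket prod p (m - 1) n a b = 0 := by
  cases m with
  | zero => simp [modeBracket_apply, hsesq1]
  | succ m =>
    simp only [modeBracket_apply, hsesq1]
    rw [sum_range_succ']
    simp only [Nat.cast_zero, zero_smul, neg_zero, map_zero, smul_zero, add_zero, smul_sum,
      Nat.add_sub_cancel]
    rw [← sum_add_distrib]
    refine sum_eq_zero fun j _ => ?_
    have hc : ((m + 1).choose (j + 1) : F) * ((j + 1 : ℕ) : F)
        = ((m + 1 : ℕ) : F) * (m.choose j : F) := by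
      rw [← Nat.cast_mul, ← Nat.cast_mul, Nat.add_one_mul_choose_eq]
    rw [map_neg, map_smul, smul_neg, smul_smul, smul_smul, hc,
      show m + 1 + n - (j + 1) = m + n - j by omega, neg_add_cancel]

lemma modeBracket_deriv_right
    (hsesq2 : ∀ (a b : R) (j : ℕ),
      prod j a (D b) = D (prod j a b) + (j : F) • prod (j - 1) a b)
    (hp : ∀ (a : R) (n : ℕ), p n (D a) = -((n : F) • p (n - 1) a))
    (m n : ℕ) (a b : R) :
    modeBracket prod p m n a (D b) + (n : F) • modeBracket prod p m (n - 1) a b = 0 := by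
  have hshift : ∑ j ∈ range (m + 1), ((m.choose j : F) * (j : F)) •
        p (m + n - j) (prod (j - 1) a b)
      = ∑ j ∈ range (m + 1), ((m.choose j : F) * ((m : F) - (j : F))) •
        p (m + n - j - 1) (prod j a b) := by
    rw [sum_range_succ', sum_range_succ]
    simp only [Nat.cast_zero, mul_zero, zero_smul, add_zero, sub_self]
    refine sum_congr rfl fun j hj => ?_
    have hj' : j < m := mem_range.1 hj
    have hc : (m.choose (j + 1) : F) * ((j + 1 : ℕ) : F)
        = (m.choose j : F) * ((m : F) - (j : F)) := by
      rw [← Nat.cast_sub hj'.le, ← Nat.cast_mul, ← Nat.cast_mul, Nat.choose_succ_right_eq]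
    rw [hc, Nat.add_sub_cancel, show m + n - (j + 1) = m + n - j - 1 by omega]
  have hsplit : modeBracket prod p m n a (D b)
      = ∑ j ∈ range (m + 1), (m.choose j : F) • p (m + n - j) (D (prod j a b))
        + ∑ j ∈ range (m + 1), ((m.choose j : F) * (j : F)) •
          p (m + n - j) (prod (j - 1) a b) := by
    rw [modeBracket_apply, ← sum_add_distrib]
    refine sum_congr rfl fun j _ => ?_
    rw [hsesq2, map_add, smul_add, map_smul, smul_smul]
  rw [hsplit, hshift, modeBracket_apply, smul_sum, ← sum_add_distrib, ← sum_add_distrib]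
  refine sum_eq_zero fun j hj => ?_
  have hj' : j ≤ m := Nat.lt_succ_iff.1 (mem_range.1 hj)
  rw [hp, smul_neg, smul_smul, smul_smul]
  have hn : ((n : F) * (m.choose j : F)) • p (m + (n - 1) - j) (prod j a b)
      = ((n : F) * (m.choose j : F)) • p (m + n - j - 1) (prod j a b) := by
    cases n with
    | zero => simp
    | succ n => rw [show m + (n + 1 - 1) - j = m + (n + 1) - j - 1 by omega]
  rw [hn, ← neg_smul, ← add_smul, ← add_smul, Nat.cast_sub (by omega), Nat.cast_add]
  convert zero_smul F _ using 2
  ring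

lemma mode_deriv_pow (hp : ∀ (a : R) (n : ℕ), p n (D a) = -((n : F) • p (n - 1) a))
    (t k : ℕ) (a : R) :
    p k ((D ^ t) a) = ((-1) ^ t * (t.factorial : F) * (k.choose t : F)) • p (k - t) a := by
  induction t generalizing k with
  | zero => simp
  | succ t ih =>
    rw [pow_succ', Module.End.mul_apply, hp, ih, smul_smul, ← neg_smul]
    cases k with
    | zero => simp
    | succ k =>
      have hc : ((k + 1 : ℕ) : F) * (k.choose t : F)
          = ((k + 1).choose (t + 1) : F) * ((t + 1 : ℕ) : F) := by
        rw [← Nat.cast_mul, ← Nat.cast_mul, Nat.add_one_mul_choose_eq]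
      rw [Nat.add_sub_cancel, Nat.add_sub_add_right, Nat.factorial_succ]
      congr 1
      rw [Nat.cast_mul, pow_succ]
      linear_combination (-(-1) ^ t * (t.factorial : F)) * hc

lemma modeBracket_skew [CharZero F]
    (hfin : ∀ a b : R, ∃ N, ∀ j, N ≤ j → prod j a b = 0)
    (hskew : ∀ (a b : R) (j N : ℕ), (∀ m, N ≤ m → prod m b a = 0) →
      prod j a b = ∑ t ∈ Finset.range N,
        ((-1 : F) ^ (j + t + 1) / (t.factorial : F)) • (D ^ t) (prod (j + t) b a))
    (hp : ∀ (a : R) (n : ℕ), p n (D a) = -((n : F) • p (n - 1) a))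
    (m n : ℕ) (a b : R) :
    modeBracket prod p m n a b = -modeBracket prod p n m b a := by
  obtain ⟨N₀, hN₀⟩ := hfin b a
  have hN : ∀ k, N₀ + (m + n + 1) ≤ k → prod k b a = 0 := fun k hk => hN₀ k (by omega)
  have key := sum_neg_one_pow_choose_mul_choose_smul (F := F)
    (fun q => p (m + n - q) (prod q b a))
    (show m + n < N₀ + (m + n + 1) by omega)
  rw [modeBracket_apply, modeBracket_apply, add_comm n m, ← key, ← sum_neg_distrib]
  refine sum_congr rfl fun j _ => ?_
  rw [hskew a b j _ hN, map_sum, smul_sum, ← sum_neg_distrib]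
  refine sum_congr rfl fun t _ => ?_
  rw [map_smul, mode_deriv_pow hp, smul_smul, smul_smul, Nat.sub_sub, ← neg_smul]
  congr 1
  have ht : (t.factorial : F) ≠ 0 := by exact_mod_cast t.factorial_ne_zero
  have hs : ((-1 : F) ^ t) * (-1) ^ t = 1 := by rw [← mul_pow]; simp
  field_simp
  rw [pow_succ, pow_add]
  linear_combination (-(m.choose j : F) * (-1) ^ j * ((m + n - j).choose t : F)) * hs

/-- The Jacobi identity for modes, with all brackets expanded through the defining formula. -/
lemma modeBracket_jacobi
    (hjacobi : ∀ (a b c : R) (m n : ℕ),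
      prod m a (prod n b c) - prod n b (prod m a c)
        = ∑ j ∈ Finset.range (m + 1), (m.choose j : F) • prod (m + n - j) (prod j a b) c)
    (m n k : ℕ) (a b c : R) :
    ∑ i ∈ range (n + 1), (n.choose i : F) • modeBracket prod p m (n + k - i) a (prod i b c)
      - ∑ j ∈ range (m + 1), (m.choose j : F) •
          modeBracket prod p n (m + k - j) b (prod j a c)
      = ∑ l ∈ range (m + 1), (m.choose l : F) •
          modeBracket prod p (m + n - l) k (prod l a b) c := by
  have hright : ∀ l ∈ range (m + 1), (m.choose l : F) •
      modeBracket prod p (m + n - l) k (prod l a b) c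
      = ∑ i ∈ range (n + 1), ∑ j ∈ range (m + 1),
        ((n.choose i : F) * (m.choose j : F) * (j.choose l : F)) •
          p (m + n + k - i - j) (prod (j + i - l) (prod l a b) c) := by
    intro l hl
    have hl' : l ≤ m := Nat.lt_succ_iff.1 (mem_range.1 hl)
    obtain ⟨d, rfl⟩ := Nat.exists_eq_add_of_le hl'
    rw [modeBracket_apply, show l + d + n - l = d + n by omega,
      ← sum_choose_mul_choose_smul (F := F)
        (fun q => p (d + n + k - q) (prod q (prod l a b) c)), smul_sum]
    refine sum_congr rfl fun i _ => ?_
    rw [show l + d + 1 = l + (d + 1) by omega, sum_range_add _ l, smul_sum]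
    rw [sum_eq_zero (s := range l), zero_add]
    · refine sum_congr rfl fun j hj => ?_
      have hc : ((l + d).choose (l + j) : F) * ((l + j).choose l : F)
          = ((l + d).choose l : F) * (d.choose j : F) := by
        have h := Nat.choose_mul (n := l + d) (k := l + j) (s := l)
          (Nat.le_add_right l j)
        rw [Nat.add_sub_cancel_left, Nat.add_sub_cancel_left] at h
        rw [← Nat.cast_mul, ← Nat.cast_mul, h]
      rw [smul_smul, show l + d + n + k - i - (l + j) = d + n + k - (i + j) by omega,
        show l + j + i - l = i + j by omega]
      congr 1
      linear_combination (-(n.choose i : F)) * hc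
    · intro j hj
      rw [Nat.choose_eq_zero_of_lt (n := j) (k := l) (mem_range.1 hj)]
      simp
  rw [sum_congr rfl hright, sum_comm]
  have hleft : ∑ j ∈ range (m + 1), (m.choose j : F) •
      modeBracket prod p n (m + k - j) b (prod j a c)
      = ∑ i ∈ range (n + 1), ∑ j ∈ range (m + 1), ((n.choose i : F) * (m.choose j : F)) •
          p (m + n + k - i - j) (prod i b (prod j a c)) := by
    simp only [modeBracket_apply, smul_sum]
    rw [sum_comm]
    refine sum_congr rfl fun i hi => sum_congr rfl fun j hj => ?_
    have hi' := mem_range.1 hi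
    have hj' := mem_range.1 hj
    rw [smul_smul, mul_comm, show n + (m + k - j) - i = m + n + k - i - j by omega]
  rw [hleft, ← sum_sub_distrib]
  refine sum_congr rfl fun i hi => ?_
  rw [sum_comm, modeBracket_apply, smul_sum, ← sum_sub_distrib]
  refine sum_congr rfl fun j hj => ?_
  have hi' := mem_range.1 hi
  have hj' := mem_range.1 hj
  rw [smul_smul, show m + (n + k - i) - j = m + n + k - i - j by omega, ← smul_sub, ← map_sub,
    hjacobi, map_sum, smul_sum]
  have hsub : range (j + 1) ⊆ range (m + 1) := range_subset_range.2 hj'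
  rw [← sum_subset hsub]
  · refine sum_congr rfl fun l _ => ?_
    rw [map_smul, smul_smul]
  · intro l _ hl
    rw [Nat.choose_eq_zero_of_lt (n := j) (by simpa using hl)]
    simp

end ModeBracket

/-- Let `R` be a Lie conformal algebra.  On
`Lie₋R = R[[t]]/(∂+∂_t)R[[t]]` (formal series in `t`, encoded as `ℕ →₀ R` with
`a_n` the image of `a tⁿ`, and `T = ∂ + ∂_t`), the bracket
`[a_m, b_n] = Σ_{j≥0} C(m,j) (a_(j) b)_{m+n−j}` is well defined and satisfies
skewsymmetry and the Jacobi identity, making `Lie₋R` a Lie algebra; moreover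
`(∂a)_n = −n a_{n−1}` holds in `Lie₋R`. -/
theorem stmt11 (F : Type*) [Field F] [CharZero F]
    (R : Type*) [AddCommGroup R] [Module F R]
    (D : Module.End F R)  -- the action of ∂ on R
    (prod : ℕ → R →ₗ[F] R →ₗ[F] R)  -- the j-th products a_(j) b
    (hfin : ∀ a b : R, ∃ N, ∀ j, N ≤ j → prod j a b = 0)
    (hsesq1 : ∀ (a b : R) (j : ℕ), prod j (D a) b = -((j : F) • prod (j - 1) a b))
    (hsesq2 : ∀ (a b : R) (j : ℕ),
        prod j a (D b) = D (prod j a b) + (j : F) • prod (j - 1) a b)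
    (hskew : ∀ (a b : R) (j N : ℕ), (∀ m, N ≤ m → prod m b a = 0) →
        prod j a b = ∑ t ∈ Finset.range N,
          ((-1 : F) ^ (j + t + 1) / (t.factorial : F)) • (D ^ t) (prod (j + t) b a))
    (hjacobi : ∀ (a b c : R) (m n : ℕ),
        prod m a (prod n b c) - prod n b (prod m a c)
          = ∑ j ∈ Finset.range (m + 1),
              (m.choose j : F) • prod (m + n - j) (prod j a b) c)
    -- T = ∂ + ∂_t on R[t]:  T(a tⁿ) = (∂a) tⁿ + n a t^{n−1}
    (T : (ℕ →₀ R) →ₗ[F] (ℕ →₀ R))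
    (hT : ∀ (n : ℕ) (a : R),
        T (Finsupp.single n a)
          = Finsupp.single n (D a) + (n : F) • Finsupp.single (n - 1) a) :
    -- conclusion: the Lie bracket on the quotient Lie₋R
    ∃ B : ((ℕ →₀ R) ⧸ LinearMap.range T) →ₗ[F]
          ((ℕ →₀ R) ⧸ LinearMap.range T) →ₗ[F] ((ℕ →₀ R) ⧸ LinearMap.range T),
      -- the defining formula [a_m, b_n] = Σ_j C(m,j) (a_(j) b)_{m+n−j}
      (∀ (a b : R) (m n : ℕ),
          B ((LinearMap.range T).mkQ (Finsupp.single m a))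
              ((LinearMap.range T).mkQ (Finsupp.single n b))
            = ∑ j ∈ Finset.range (m + 1),
                (m.choose j : F) •
                  (LinearMap.range T).mkQ (Finsupp.single (m + n - j) (prod j a b))) ∧
      -- skewsymmetry
      (∀ x y, B x y = -(B y x)) ∧
      -- Jacobi identity
      (∀ x y z, B x (B y z) - B y (B x z) = B (B x y) z) ∧
      -- (∂a)_n = −n a_{n−1} in Lie₋R
      (∀ (a : R) (n : ℕ),
          (LinearMap.range T).mkQ (Finsupp.single n (D a))
            = -((n : F) • (LinearMap.range T).mkQ (Finsupp.single (n - 1) a))) := by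
  set Q := (LinearMap.range T).mkQ with hQ
  set p : ℕ → R →ₗ[F] ((ℕ →₀ R) ⧸ LinearMap.range T) :=
    fun n => Q ∘ₗ Finsupp.lsingle n with hp_def
  have hpQ : ∀ n a, Q (Finsupp.single n a) = p n a := fun _ _ => rfl
  have hp : ∀ (a : R) (n : ℕ), p n (D a) = -((n : F) • p (n - 1) a) := by
    intro a n
    have h : Q (T (Finsupp.single n a)) = 0 := by
      rw [hQ, Submodule.mkQ_apply, Submodule.Quotient.mk_eq_zero]
      exact LinearMap.mem_range_self T _
    rw [hT, map_add, map_smul] at h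
    exact eq_neg_of_add_eq_zero_left h
  let B₀ : (ℕ →₀ R) →ₗ[F] (ℕ →₀ R) →ₗ[F] ((ℕ →₀ R) ⧸ LinearMap.range T) :=
    Finsupp.lsum F fun m =>
      LinearMap.flip (Finsupp.lsum F fun n => (modeBracket prod p m n).flip)
  have hB₀ : ∀ m n a b, B₀ (Finsupp.single m a) (Finsupp.single n b)
      = modeBracket prod p m n a b := by
    intro m n a b
    simp [B₀]
  have hleft : ∀ x y, B₀ (T x) y = 0 := by
    intro x y
    induction x using Finsupp.induction_linear with
    | zero => simp
    | add x₁ x₂ h₁ h₂ => simp [h₁, h₂]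
    | single m a =>
      induction y using Finsupp.induction_linear with
      | zero => simp
      | add y₁ y₂ h₁ h₂ => simp [h₁, h₂]
      | single n b =>
        rw [hT, map_add, map_smul, LinearMap.add_apply, LinearMap.smul_apply, hB₀, hB₀]
        exact modeBracket_deriv_left hsesq1 m n a b
  have hright : ∀ x y, B₀ x (T y) = 0 := by
    intro x y
    induction x using Finsupp.induction_linear with
    | zero => simp
    | add x₁ x₂ h₁ h₂ => simp [h₁, h₂]
    | single m a =>
      induction y using Finsupp.induction_linear with
      | zero => simp
      | add y₁ y₂ h₁ h₂ => simp [h₁, h₂]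
      | single n b =>
        rw [hT, map_add, map_smul, hB₀, hB₀]
        exact modeBracket_deriv_right hsesq2 hp m n a b
  let B₁ : ((ℕ →₀ R) ⧸ LinearMap.range T) →ₗ[F] (ℕ →₀ R) →ₗ[F]
      ((ℕ →₀ R) ⧸ LinearMap.range T) :=
    (LinearMap.range T).liftQ B₀ (by
      rintro _ ⟨x, rfl⟩
      exact LinearMap.ext (hleft x))
  let B : ((ℕ →₀ R) ⧸ LinearMap.range T) →ₗ[F] ((ℕ →₀ R) ⧸ LinearMap.range T) →ₗ[F]
      ((ℕ →₀ R) ⧸ LinearMap.range T) :=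
    ((LinearMap.range T).liftQ B₁.flip (by
      rintro _ ⟨y, rfl⟩
      refine LinearMap.ext fun x => ?_
      obtain ⟨x, rfl⟩ := (LinearMap.range T).mkQ_surjective x
      exact hright x y)).flip
  have hB : ∀ m n a b, B (p m a) (p n b) = modeBracket prod p m n a b := hB₀
  have ind : ∀ P : ((ℕ →₀ R) ⧸ LinearMap.range T) → Prop, P 0 →
      (∀ x y, P x → P y → P (x + y)) → (∀ n a, P (p n a)) → ∀ x, P x := by
    intro P h0 hadd hs x
    obtain ⟨x, rfl⟩ := (LinearMap.range T).mkQ_surjective x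
    induction x using Finsupp.induction_linear with
    | zero => simpa using h0
    | add x₁ x₂ h₁ h₂ => rw [map_add]; exact hadd _ _ h₁ h₂
    | single n a => exact hs n a
  refine ⟨B, fun a b m n => ?_, ?_, ?_, fun a n => hp a n⟩
  · exact (hB m n a b).trans (modeBracket_apply m n a b)
  · intro x y
    revert x
    refine ind _ (by simp) (fun x₁ x₂ h₁ h₂ => ?_) fun m a => ?_
    · rw [map_add, LinearMap.add_apply, h₁, h₂, map_add, neg_add]
    revert y
    refine ind _ (by simp) (fun y₁ y₂ h₁ h₂ => ?_) fun n b => ?_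
    · rw [map_add, h₁, h₂, map_add, LinearMap.add_apply, neg_add]
    rw [hB, hB]
    exact modeBracket_skew hfin hskew hp m n a b
  · intro x y z
    revert x
    refine ind _ (by simp) (fun x₁ x₂ h₁ h₂ => ?_) fun m a => ?_
    · simp only [map_add, LinearMap.add_apply, ← h₁, ← h₂]
      abel
    revert y
    refine ind _ (by simp) (fun y₁ y₂ h₁ h₂ => ?_) fun n b => ?_
    · simp only [map_add, LinearMap.add_apply, ← h₁, ← h₂]
      abel
    revert z
    refine ind _ (by simp) (fun z₁ z₂ h₁ h₂ => ?_) fun k c => ?_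
    · simp only [map_add, ← h₁, ← h₂]
      abel
    rw [hB, hB, hB, modeBracket_apply, modeBracket_apply, modeBracket_apply]
    simp only [map_sum, map_smul, LinearMap.sum_apply, LinearMap.smul_apply, hB]
    exact modeBracket_jacobi hjacobi m n k a b c
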